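/- arXiv:1911.00888 — 2 statements merged into one kernel-verified Lean document; each statement's English description precedes it below -/
import Mathlib

section
/- Let X₀, …, X_N be nonempty sets, let c : X₀ × ⋯ × X_N → ℝ be bounded, and let f_i : X_i → ℝ (i = 0,…,N) be bounded functions satisfying ∑_{i=0}^N f_i(x_i) ≤ c(x₀,…,x_N) for every tuple (x₀,…,x_N). Suppose g_i : X_i → ℝ (i = 0,…,N) are bounded functions satisfying the recursive relations g_i(x_i) = inf { c(x₀,…,x_N) − ∑_{j<i} g_j(x_j) − ∑_{j>i} f_j(x_j) : x_j ∈ X_j for all j ≠ i } for every i and every x_i ∈ X_i. Then: (a) f_i(x_i) ≤ g_i(x_i) for every i and every x_i ∈ X_i; (b) ∑_{i=0}^N g_i(x_i) ≤ c(x₀,…,x_N) for every tuple; and (c) the tuple (g₀,…,g_N) is c-conjugate, i.e. g_i(x_i) = inf { c(x₀,…,x_N) − ∑_{j≠i} g_j(x_j) : x_j ∈ X_j for all j ≠ i } for every i and every x_i ∈ X_i. -/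
open Finset

theorem aux_ne {n : ℕ} (i : Fin n) (h : Fin n → ℝ) :
    ∑ j ∈ Finset.univ.filter (fun j => j ≠ i), h j =
      ∑ j ∈ Finset.univ.filter (fun j => j < i), h j
        + ∑ j ∈ Finset.univ.filter (fun j => i < j), h j := by
  rw [← Finset.sum_union]
  · apply Finset.sum_congr _ (fun _ _ => rfl)
    ext j
    simp
  · rw [Finset.disjoint_left]
    intro j
    simp
    intro h
    exact h.le

theorem aux_all {n : ℕ} (i : Fin n) (h : Fin n → ℝ) :
    ∑ j, h j = ∑ j ∈ Finset.univ.filter (fun j => j ≠ i), h j + h i := by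
  rw [← Finset.sum_filter_add_sum_filter_not Finset.univ (fun j => j ≠ i)]
  congr 1
  simp [Finset.filter_eq']

/-- the convexification trick of the paper's Theorem 1.
Given bounded potentials `f i` feasible for the bounded cost `c`
(`∑ i f i (t i) ≤ c t` for all tuples `t`), and bounded functions `g i` satisfying the
recursive relations
`g i xᵢ = inf { c t − ∑_{j<i} g j (t j) − ∑_{j>i} f j (t j) : t i = xᵢ }`,
then (a) `f i ≤ g i` pointwise, (b) the tuple `g` is feasible, and (c) `g` is
`c`-conjugate: `g i xᵢ = inf { c t − ∑_{j≠i} g j (t j) : t i = xᵢ }`. -/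
theorem stmt9 (N : ℕ) (X : Fin (N + 1) → Type*) [∀ i, Nonempty (X i)]
    (c : (∀ i, X i) → ℝ) (hc : ∃ M : ℝ, ∀ t, |c t| ≤ M)
    (f : ∀ i, X i → ℝ) (hfb : ∀ i, ∃ M : ℝ, ∀ x, |f i x| ≤ M)
    (hfeas : ∀ t : ∀ i, X i, ∑ i, f i (t i) ≤ c t)
    (g : ∀ i, X i → ℝ) (hgb : ∀ i, ∃ M : ℝ, ∀ x, |g i x| ≤ M)
    (hrec : ∀ (i : Fin (N + 1)) (xi : X i),
      g i xi = sInf {r : ℝ | ∃ t : ∀ j, X j, t i = xi ∧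
        r = c t - (∑ j ∈ Finset.univ.filter (fun j => j < i), g j (t j))
              - ∑ j ∈ Finset.univ.filter (fun j => i < j), f j (t j)}) :
    (∀ (i : Fin (N + 1)) (xi : X i), f i xi ≤ g i xi) ∧
    (∀ t : ∀ i, X i, ∑ i, g i (t i) ≤ c t) ∧
    (∀ (i : Fin (N + 1)) (xi : X i),
      g i xi = sInf {r : ℝ | ∃ t : ∀ j, X j, t i = xi ∧
        r = c t - ∑ j ∈ Finset.univ.filter (fun j => j ≠ i), g j (t j)}) := by
  have A : ∀ (i : Fin (N + 1)) (t : ∀ i, X i), g i (t i) ≤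
      c t - (∑ j ∈ Finset.univ.filter (fun j => j < i), g j (t j))
              - ∑ j ∈ Finset.univ.filter (fun j => i < j), f j (t j) := by
    intro i t
    rw [hrec i (t i)]
    refine csInf_le ?_ ⟨t, rfl, rfl⟩
    obtain ⟨M, hM⟩ := hc
    choose F hF using hfb
    choose G hG using hgb
    refine ⟨-M - (∑ j ∈ Finset.univ.filter (fun j => j < i), G j)
      - ∑ j ∈ Finset.univ.filter (fun j => i < j), F j, ?_⟩
    rintro r ⟨s, -, rfl⟩
    have h1 := (abs_le.1 (hM s)).1
    have h2 : ∑ j ∈ Finset.univ.filter (fun j => j < i), g j (s j) ≤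
      ∑ j ∈ Finset.univ.filter (fun j => j < i), G j :=
      Finset.sum_le_sum fun j _ => (abs_le.1 (hG j (s j))).2
    have h3 : ∑ j ∈ Finset.univ.filter (fun j => i < j), f j (s j) ≤
      ∑ j ∈ Finset.univ.filter (fun j => i < j), F j :=
      Finset.sum_le_sum fun j _ => (abs_le.1 (hF j (s j))).2
    linarith
  have ex : ∀ (i : Fin (N + 1)) (xi : X i), ∃ t : ∀ j, X j, t i = xi := fun i xi =>
    ⟨Function.update (fun j => Classical.arbitrary (X j)) i xi, by simp⟩
  have a : ∀ (i : Fin (N + 1)) (xi : X i), f i xi ≤ g i xi := by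
    intro i xi
    rw [hrec i xi]
    obtain ⟨t0, ht0⟩ := ex i xi
    refine le_csInf ⟨_, t0, ht0, rfl⟩ ?_
    rintro r ⟨t, rfl, rfl⟩
    induction i using Fin.cases with
    | zero =>
      have h1 := hfeas t
      rw [aux_all 0, aux_ne] at h1
      have h2 : (Finset.univ.filter (fun j : Fin (N + 1) => j < 0)) = ∅ := by
        ext j; simp
      rw [h2] at h1 ⊢
      simp only [Finset.sum_empty] at h1 ⊢
      linarith
    | succ k =>
      have h1 := A k.castSucc t
      have h2 : (Finset.univ.filter (fun j : Fin (N + 1) => j < k.succ)) =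
          insert k.castSucc (Finset.univ.filter (fun j : Fin (N + 1) => j < k.castSucc)) := by
        ext j
        simp [Fin.lt_def, Fin.ext_iff]
        omega
      have h3 : (Finset.univ.filter (fun j : Fin (N + 1) => k.castSucc < j)) =
          insert k.succ (Finset.univ.filter (fun j : Fin (N + 1) => k.succ < j)) := by
        ext j
        simp [Fin.lt_def, Fin.ext_iff]
        omega
      rw [h3, Finset.sum_insert (by simp)] at h1
      rw [h2, Finset.sum_insert (by simp)]
      linarith
  have b : ∀ t : ∀ i, X i, ∑ i, g i (t i) ≤ c t := by
    intro t
    have h1 := A (Fin.last N) t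
    have h2 : (Finset.univ.filter (fun j : Fin (N + 1) => Fin.last N < j)) = ∅ := by
      ext j; simp [Fin.le_last]
    rw [aux_all (Fin.last N), aux_ne]
    rw [h2] at h1 ⊢
    simp only [Finset.sum_empty] at h1 ⊢
    linarith
  refine ⟨a, b, ?_⟩
  intro i xi
  obtain ⟨t0, ht0⟩ := ex i xi
  have lb : ∀ r ∈ {r : ℝ | ∃ t : ∀ j, X j, t i = xi ∧
        r = c t - ∑ j ∈ Finset.univ.filter (fun j => j ≠ i), g j (t j)}, g i xi ≤ r := by
    rintro r ⟨t, rfl, rfl⟩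
    have h1 := b t
    rw [aux_all i] at h1
    linarith
  apply le_antisymm
  · exact le_csInf ⟨_, t0, ht0, rfl⟩ lb
  · conv_rhs => rw [hrec i xi]
    refine le_csInf ⟨_, t0, ht0, rfl⟩ ?_
    rintro r ⟨t, ht, rfl⟩
    refine (csInf_le ⟨_, lb⟩ ⟨t, ht, rfl⟩).trans ?_
    rw [aux_ne]
    have h3 : ∑ j ∈ Finset.univ.filter (fun j => i < j), f j (t j) ≤
      ∑ j ∈ Finset.univ.filter (fun j => i < j), g j (t j) :=
      Finset.sum_le_sum fun j _ => a j (t j)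
    linarith
end

section
/- Let S₀, S₁, …, S_N be nonempty, finite, pairwise disjoint subsets of ℝ^d with |S_i| = n_i, let c : (ℝ^d)^{N+1} → ℝ, and let λ₀ = 1 and λ₁, …, λ_N ∈ ℝ satisfy ∑_{i=0}^N λ_i = 0. Call a function f : ℝ^d → ℝ feasible if ∑_{i=0}^N λ_i f(z_i) ≤ c(z₀, z₁, …, z_N) for every tuple (z₀,…,z_N) ∈ S₀ × S₁ × ⋯ × S_N, and define the objective ĥ(f) = ∑_{i=0}^N (λ_i / n_i) ∑_{z ∈ S_i} f(z). If f* is feasible and maximizes ĥ over all feasible functions, then for every z₀ ∈ S₀, f*(z₀) = min { c(z₀, z₁, …, z_N) − ∑_{j=1}^N λ_j f*(z_j) : (z₁,…,z_N) ∈ S₁ × ⋯ × S_N }. -/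
open Finset

/-- A function `f` is feasible for the discrete shared-potential dual problem with
sample sets `S i`, weights `lam i`, and cost `c` if
`∑ i lam i · f (z i) ≤ c z` for every tuple `z` with `z i ∈ S i`. -/
def DualFeasible {d N : ℕ} (S : Fin (N + 1) → Finset (EuclideanSpace ℝ (Fin d)))
    (lam : Fin (N + 1) → ℝ) (c : (Fin (N + 1) → EuclideanSpace ℝ (Fin d)) → ℝ)
    (f : EuclideanSpace ℝ (Fin d) → ℝ) : Prop :=
  ∀ z : Fin (N + 1) → EuclideanSpace ℝ (Fin d),
    (∀ i, z i ∈ S i) → ∑ i, lam i * f (z i) ≤ c z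

/-- The objective `ĥ(f) = ∑ i (lam i / |S i|) ∑_{z ∈ S i} f z` of the discrete
shared-potential dual problem. -/
noncomputable def dualObj {d N : ℕ} (S : Fin (N + 1) → Finset (EuclideanSpace ℝ (Fin d)))
    (lam : Fin (N + 1) → ℝ) (f : EuclideanSpace ℝ (Fin d) → ℝ) : ℝ :=
  ∑ i, (lam i / ((S i).card : ℝ)) * ∑ z ∈ S i, f z

/-- the paper's Lemma 3, Appendix B.  With nonempty, pairwise
disjoint finite sample sets `S 0, …, S N` in `ℝ^d`, weights `lam 0 = 1`,
`∑ i lam i = 0`, and cost `c`, if `f*` is feasible and maximizes the objective `ĥ`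
over all feasible functions, then for every `z₀ ∈ S 0`, `f* z₀` is the minimum of
`c(z₀, z₁, …, z_N) − ∑_{j=1}^N lam j · f*(z j)` over all `(z₁,…,z_N) ∈ S 1 × ⋯ × S N`. -/
theorem stmt10 (d N : ℕ)
    (S : Fin (N + 1) → Finset (EuclideanSpace ℝ (Fin d)))
    (hSne : ∀ i, (S i).Nonempty)
    (hSdisj : ∀ i j, i ≠ j → Disjoint (S i) (S j))
    (c : (Fin (N + 1) → EuclideanSpace ℝ (Fin d)) → ℝ)
    (lam : Fin (N + 1) → ℝ) (hlam0 : lam 0 = 1) (hlamsum : ∑ i, lam i = 0)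
    (fstar : EuclideanSpace ℝ (Fin d) → ℝ)
    (hfeas : DualFeasible S lam c fstar)
    (hopt : ∀ g : EuclideanSpace ℝ (Fin d) → ℝ,
      DualFeasible S lam c g → dualObj S lam g ≤ dualObj S lam fstar) :
    ∀ z₀ ∈ S 0,
      IsLeast {r : ℝ | ∃ z : Fin (N + 1) → EuclideanSpace ℝ (Fin d),
          z 0 = z₀ ∧ (∀ i : Fin N, z i.succ ∈ S i.succ) ∧
          r = c z - ∑ i : Fin N, lam i.succ * fstar (z i.succ)}
        (fstar z₀) := by
  classical
  intro z₀ hz₀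
  have hlow : ∀ z : Fin (N + 1) → EuclideanSpace ℝ (Fin d), z 0 = z₀ →
      (∀ i : Fin N, z i.succ ∈ S i.succ) →
      fstar z₀ ≤ c z - ∑ i : Fin N, lam i.succ * fstar (z i.succ) := by
    intro z h0 hz
    have h := hfeas z (fun i => Fin.cases (by rw [h0]; exact hz₀) hz i)
    rw [Fin.sum_univ_succ, hlam0, h0] at h
    linarith
  refine ⟨?_, ?_⟩
  swap
  · rintro r ⟨z, h0, hz, rfl⟩
    exact hlow z h0 hz
  have hTne : (Fintype.piFinset (fun i : Fin N => S i.succ)).Nonempty :=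
    Fintype.piFinset_nonempty.2 (fun i => hSne i.succ)
  obtain ⟨w, hw, hmin⟩ := Finset.exists_min_image _
    (fun w : Fin N → EuclideanSpace ℝ (Fin d) =>
      c (Fin.cons z₀ w) - ∑ i : Fin N, lam i.succ * fstar (w i)) hTne
  rw [Fintype.mem_piFinset] at hw
  have hle := hlow (Fin.cons z₀ w) (by simp) (by simpa using hw)
  simp only [Fin.cons_succ] at hle
  refine ⟨Fin.cons z₀ w, by simp, by simpa using hw, ?_⟩
  simp only [Fin.cons_succ]
  by_contra hne
  have hlt := lt_of_le_of_ne hle hne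
  set m := c (Fin.cons z₀ w) - ∑ i : Fin N, lam i.succ * fstar (w i) with hm
  have hg : ∀ i : Fin N, ∀ x ∈ S i.succ, Function.update fstar z₀ m x = fstar x := by
    intro i x hx
    apply Function.update_of_ne
    rintro rfl
    exact Finset.disjoint_left.1 (hSdisj 0 i.succ (Fin.succ_ne_zero i).symm) hz₀ hx
  have hfg : DualFeasible S lam c (Function.update fstar z₀ m) := by
    intro z hz
    have h1 := hfeas z hz
    rw [Fin.sum_univ_succ] at h1 ⊢
    rw [Finset.sum_congr rfl (fun i _ => by rw [hg i _ (hz i.succ)])]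
    by_cases h0 : z 0 = z₀
    · have h2 := hmin (fun i => z i.succ) (Fintype.mem_piFinset.2 (fun i => hz i.succ))
      have h3 : (Fin.cons z₀ (fun i : Fin N => z i.succ) :
          Fin (N + 1) → EuclideanSpace ℝ (Fin d)) = z := by
        rw [← h0]; exact Fin.cons_self_tail z
      simp only [h3] at h2
      rw [h0, Function.update_self, hlam0]
      linarith
    · rwa [Function.update_of_ne h0]
  have hobj := hopt _ hfg
  unfold dualObj at hobj
  rw [Fin.sum_univ_succ, Fin.sum_univ_succ] at hobj
  have hsum : ∀ i : Fin N, ∑ z ∈ S i.succ, Function.update fstar z₀ m z =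
      ∑ z ∈ S i.succ, fstar z := fun i => Finset.sum_congr rfl (hg i)
  simp only [hsum] at hobj
  have hS : ∑ z ∈ S 0, fstar z < ∑ z ∈ S 0, Function.update fstar z₀ m z := by
    apply Finset.sum_lt_sum
    · intro x _
      by_cases hx : x = z₀
      · rw [hx, Function.update_self]; exact hlt.le
      · rw [Function.update_of_ne hx]
    · exact ⟨z₀, hz₀, by rw [Function.update_self]; exact hlt⟩
  have hpos : 0 < lam 0 / ((S 0).card : ℝ) := by
    rw [hlam0]
    have : 0 < (S 0).card := (hSne 0).card_pos
    positivity
  have := mul_lt_mul_of_pos_left hS hpos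
  linarith
end
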